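/- arXiv:1311.6938 — 2 statements merged into one kernel-verified Lean document; each statement's English description precedes it below -/
import Mathlib

section
/- For each 1 ≤ i ≤ k there exist real numbers b_{i,m}, k−i+1 ≤ m ≤ k, depending only on k, i and m (in particular independent of j, of N, and of the mesh), with b_{1,k} = 1/(2k+1), such that on every cell τ_j, F_i = Σ_{m=k−i+1}^{k} b_{i,m} (L_{j,m} − L_{j,m−1}). In particular F_i(x_{j+1/2}) = 0, and there is a constant C depending only on k such that sup_{τ_j} |F_i| ≤ C for all j and all 1 ≤ i ≤ k. -/
open MeasureTheory intervalIntegral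

/-- Legendre polynomial of degree `m` via the Rodrigues formula. -/
noncomputable def legendreP (m : ℕ) : ℝ → ℝ :=
  fun s => (1 / ((2:ℝ) ^ m * (Nat.factorial m : ℝ))) *
    iteratedDeriv m (fun t : ℝ => (t ^ 2 - 1) ^ m) s

/-- Legendre polynomial rescaled to the cell `(a, b)`. -/
noncomputable def legendreCell (m : ℕ) (a b : ℝ) : ℝ → ℝ :=
  fun x => legendreP m ((2 * x - (a + b)) / (b - a))

/-- `P` is the Gauss–Radau projection (onto polynomials of degree ≤ k on `(a,b)`) of `u`. -/
def IsGRProj (k : ℕ) (a b : ℝ) (u : ℝ → ℝ) (P : Polynomial ℝ) : Prop :=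
  P.natDegree ≤ k ∧
  (∀ v : Polynomial ℝ, v.natDegree + 1 ≤ k →
    (∫ x in a..b, P.eval x * v.eval x) = ∫ x in a..b, u x * v.eval x) ∧
  P.eval b = u b

/-- The scaled primitive `(D⁻¹ v)(x) = (2/(b-a)) ∫_a^x v`. -/
noncomputable def Dinv (a b : ℝ) (v : ℝ → ℝ) : ℝ → ℝ :=
  fun x => (2 / (b - a)) * ∫ t in a..x, v t

/-- `F` is the sequence of correction polynomials on the cell `(a,b)`:
`F 1 = P_h^-(D⁻¹ L_k)` and `F i = -P_h^-(D⁻¹ F (i-1))` for `i ≥ 2`. -/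
def IsFSeq (k : ℕ) (a b : ℝ) (F : ℕ → Polynomial ℝ) : Prop :=
  IsGRProj k a b (Dinv a b (legendreCell k a b)) (F 1) ∧
  ∀ i, 2 ≤ i → IsGRProj k a b (Dinv a b (fun x => (F (i-1)).eval x)) (-(F i))

/-- The `m`-th Radau coefficient of `w` on the cell `(a,b)`. -/
noncomputable def radauCoeff (a b : ℝ) (w : ℝ → ℝ) (m : ℕ) : ℝ :=
  w b - (1 / (b - a)) *
    ∫ x in a..b, w x * ∑ l ∈ Finset.range m, (2 * (l:ℝ) + 1) * legendreCell l a b x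

/-- `G_i(t) = (d/dt)^i u_{j,k+1}(t)` for `u(x,t) = u0(x - t)` on the cell `(a,b)`. -/
noncomputable def Gfun (k : ℕ) (a b : ℝ) (u0 : ℝ → ℝ) (i : ℕ) (t : ℝ) : ℝ :=
  iteratedDeriv i (fun s => radauCoeff a b (fun y => u0 (y - s)) (k + 1)) t

/-- `w_i(x,t) = (h_j/2)^i G_i(t) F_i(x)` on the cell `(a,b)`. -/
noncomputable def wFun (k : ℕ) (a b : ℝ) (u0 : ℝ → ℝ) (F : ℕ → Polynomial ℝ)
    (i : ℕ) (y t : ℝ) : ℝ :=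
  ((b - a) / 2) ^ i * Gfun k a b u0 i t * (F i).eval y

/-- `w^l = Σ_{i=1}^l w_i` on the cell `(a,b)`. -/
noncomputable def wSum (k : ℕ) (a b : ℝ) (u0 : ℝ → ℝ) (F : ℕ → Polynomial ℝ)
    (l : ℕ) (y t : ℝ) : ℝ :=
  ∑ i ∈ Finset.Icc 1 l, wFun k a b u0 F i y t

/-- The interpolation function `u_I^l = P_h^- u - w^l` on the cell `(a,b)`;
here `P t` is the Gauss–Radau projection of `u(·,t)`. -/
noncomputable def uIl (k : ℕ) (a b : ℝ) (u0 : ℝ → ℝ) (P : ℝ → Polynomial ℝ)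
    (F : ℕ → Polynomial ℝ) (l : ℕ) (y t : ℝ) : ℝ :=
  (P t).eval y - wSum k a b u0 F l y t

/-- `uh` is a DG solution on `[0,T]` on the mesh `x 0 < x 1 < … < x N`
(the piece on the cell `τ_j = (x (j-1), x j)` is the polynomial `uh j t`),
with prescribed inflow value `inflow t` at the left boundary. -/
def IsDGSol (k N : ℕ) (x : ℕ → ℝ) (T : ℝ) (inflow : ℝ → ℝ)
    (uh : ℕ → ℝ → Polynomial ℝ) : Prop :=
  (∀ j ∈ Finset.Icc 1 N, ∀ t : ℝ, (uh j t).natDegree ≤ k) ∧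
  (∀ j ∈ Finset.Icc 1 N, ∀ y : ℝ, ContDiff ℝ 1 (fun t => (uh j t).eval y)) ∧
  (∀ j ∈ Finset.Icc 1 N, ∀ t ∈ Set.Icc (0:ℝ) T, ∀ v : Polynomial ℝ, v.natDegree ≤ k →
    (∫ y in (x (j-1))..(x j), deriv (fun s => (uh j s).eval y) t * v.eval y)
      - (∫ y in (x (j-1))..(x j), (uh j t).eval y * v.derivative.eval y)
      + (uh j t).eval (x j) * v.eval (x j)
      - (if j = 1 then inflow t else (uh (j-1) t).eval (x (j-1))) * v.eval (x (j-1)) = 0)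

/-- The error `u - u_I^l` on the cell `τ_j`, as a function of `(y, s)`. -/
noncomputable def errFun (k l : ℕ) (x : ℕ → ℝ) (u0 : ℝ → ℝ)
    (P : ℕ → ℝ → Polynomial ℝ) (F : ℕ → ℕ → Polynomial ℝ) (j : ℕ) (y s : ℝ) : ℝ :=
  u0 (y - s) - uIl k (x (j-1)) (x j) u0 (P j) (F j) l y s

open Polynomial

noncomputable def legPoly (m : ℕ) : ℝ[X] :=
  C (1 / ((2:ℝ) ^ m * (Nat.factorial m : ℝ))) * derivative^[m] ((X ^ 2 - 1) ^ m)

lemma iteratedDeriv_poly (m : ℕ) (p : ℝ[X]) :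
    iteratedDeriv m (fun t => p.eval t) = fun t => (derivative^[m] p).eval t := by
  induction m with
  | zero => simp
  | succ n ih =>
    rw [iteratedDeriv_succ, ih, Function.iterate_succ_apply']
    funext t
    simp

lemma legendreP_eq (m : ℕ) (s : ℝ) : legendreP m s = (legPoly m).eval s := by
  have h := iteratedDeriv_poly m ((X ^ 2 - 1) ^ m)
  simp only [eval_pow, eval_sub, eval_X, eval_one] at h
  simp only [legendreP, legPoly, h, eval_mul, eval_C]

lemma lp_eval_one (m : ℕ) : (legPoly m).eval 1 = 1 := by
  have h := aeval_iterate_derivative_self ((X ^ 2 - 1 : ℝ[X]) ^ m) m (1:ℝ) (p' := (X + 1) ^ m)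
    (by simp only [Algebra.algebraMap_self, Polynomial.map_id, ← mul_pow]; congr 1; simp; ring)
  simp only [coe_aeval_eq_eval] at h
  rw [legPoly, eval_mul, h]
  simp
  norm_num
  field_simp

lemma lp_eval_neg_one (m : ℕ) : (legPoly m).eval (-1) = (-1) ^ m := by
  have h := aeval_iterate_derivative_self ((X ^ 2 - 1 : ℝ[X]) ^ m) m (-1:ℝ) (p' := (X - 1) ^ m)
    (by simp only [Algebra.algebraMap_self, Polynomial.map_id, ← mul_pow]; congr 1; simp; ring)
  simp only [coe_aeval_eq_eval] at h
  rw [legPoly, eval_mul, h]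
  have : (-1 - 1 : ℝ) = (-1) * 2 := by norm_num
  simp only [eval_C, eval_pow, eval_sub, eval_X, eval_one, nsmul_eq_mul]
  rw [this, mul_pow]
  field_simp

lemma lp_deriv (m : ℕ) :
    derivative (legPoly (m + 2) - legPoly m) = C (2 * (m:ℝ) + 3) * legPoly (m + 1) := by
  have key : derivative (derivative ((X ^ 2 - 1 : ℝ[X]) ^ (m + 2)))
      = C (2 * ((m:ℝ) + 2) * (2 * m + 3)) * (X ^ 2 - 1) ^ (m + 1)
        + C (4 * ((m:ℝ) + 1) * (m + 2)) * (X ^ 2 - 1) ^ m := by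
    simp only [derivative_pow, derivative_sub, derivative_mul, derivative_X, derivative_one, map_mul, map_add]
    simp only [show (C (2:ℝ)) = 2 from rfl, show (C (3:ℝ)) = 3 from rfl, show (C (4:ℝ)) = 4 from rfl]
    simp [show (C (2:ℝ)) = 2 from rfl]
    ring
  have h2 : derivative (derivative^[m+2] ((X ^ 2 - 1 : ℝ[X]) ^ (m + 2)))
      = C (2 * ((m:ℝ) + 2) * (2 * m + 3)) * derivative^[m+1] ((X ^ 2 - 1) ^ (m + 1))
        + C (4 * ((m:ℝ) + 1) * (m + 2)) * derivative (derivative^[m] ((X ^ 2 - 1) ^ m)) := by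
    rw [← Function.iterate_succ_apply' derivative m, ← Function.iterate_succ_apply' derivative (m+2)]
    rw [Function.iterate_succ_apply, Function.iterate_succ_apply, key, iterate_map_add,
      iterate_derivative_C_mul, iterate_derivative_C_mul]
  simp only [legPoly, derivative_sub, derivative_C_mul, h2]
  have f1 : (Nat.factorial (m+1) : ℝ) = (m+1) * Nat.factorial m := by
    rw [Nat.factorial_succ]; push_cast; ring
  have f2 : (Nat.factorial (m+2) : ℝ) = (m+2) * ((m+1) * Nat.factorial m) := by
    rw [Nat.factorial_succ, Nat.cast_mul, f1]; push_cast; ring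
  rw [mul_add, ← mul_assoc, ← mul_assoc, ← mul_assoc, ← map_mul, ← map_mul, ← map_mul, f1, f2]
  have hf : (Nat.factorial m : ℝ) ≠ 0 := by positivity
  have e1 : 1 / ((2:ℝ) ^ (m + 2) * ((m + 2) * ((m + 1) * (Nat.factorial m : ℝ)))) * (4 * ((m:ℝ) + 1) * (m + 2))
     = 1 / (2 ^ m * (Nat.factorial m : ℝ)) := by
    field_simp; ring
  have e2 : 1 / ((2:ℝ) ^ (m + 2) * ((m + 2) * ((m + 1) * (Nat.factorial m : ℝ)))) * (2 * ((m:ℝ) + 2) * (2 * m + 3))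
     = (2 * m + 3) * (1 / (2 ^ (m + 1) * ((m + 1) * (Nat.factorial m : ℝ)))) := by
    field_simp; ring
  rw [e1, e2]; ring

lemma lp_natDegree (m : ℕ) : (legPoly m).natDegree ≤ m := by
  refine (natDegree_C_mul_le _ _).trans ((natDegree_iterate_derivative _ _).trans ?_)
  have : ((X ^ 2 - 1 : ℝ[X]) ^ m).natDegree ≤ m * 2 := by
    refine natDegree_pow_le_of_le m ?_
    compute_degree
  omega

lemma poly_ibp (p v : ℝ[X]) (a b : ℝ) :
    ∫ x in a..b, (derivative p).eval x * v.eval x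
      = p.eval b * v.eval b - p.eval a * v.eval a - ∫ x in a..b, p.eval x * (derivative v).eval x := by
  have h := intervalIntegral.integral_deriv_mul_eq_sub (a := a) (b := b)
    (u := fun x => p.eval x) (v := fun x => v.eval x)
    (fun x _ => p.hasDerivAt x) (fun x _ => v.hasDerivAt x)
    ((derivative p).continuous.intervalIntegrable _ _) ((derivative v).continuous.intervalIntegrable _ _)
  rw [intervalIntegral.integral_add] at h
  · linarith
  · exact (by fun_prop : Continuous _).intervalIntegrable _ _
  · exact (by fun_prop : Continuous _).intervalIntegrable _ _

lemma orth_aux (m j : ℕ) (hj : j ≤ m) : ∀ v : ℝ[X], v.natDegree < j →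
    ∫ x in (-1:ℝ)..1, (derivative^[j] ((X ^ 2 - 1 : ℝ[X]) ^ m)).eval x * v.eval x = 0 := by
  induction j with
  | zero => intro v hv; omega
  | succ j ih =>
    intro v hv
    have h1 := aeval_iterate_derivative_of_lt ((X ^ 2 - 1 : ℝ[X]) ^ m) m (1:ℝ) (p' := (X + 1) ^ m)
      (by simp only [Algebra.algebraMap_self, Polynomial.map_id, ← mul_pow]; congr 1; simp; ring) (k := j) (by omega)
    have h2 := aeval_iterate_derivative_of_lt ((X ^ 2 - 1 : ℝ[X]) ^ m) m (-1:ℝ) (p' := (X - 1) ^ m)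
      (by simp only [Algebra.algebraMap_self, Polynomial.map_id, ← mul_pow]; congr 1; simp; ring) (k := j) (by omega)
    simp only [coe_aeval_eq_eval] at h1 h2
    rw [Function.iterate_succ_apply', poly_ibp, h1, h2]
    by_cases h0 : v.natDegree = 0
    · rw [derivative_of_natDegree_zero h0]; simp
    · rw [ih (by omega) _ (lt_of_lt_of_le (natDegree_derivative_lt h0) (by omega))]; simp

lemma lp_orth (m : ℕ) (v : ℝ[X]) (hv : v.natDegree < m) :
    ∫ x in (-1:ℝ)..1, (legPoly m).eval x * v.eval x = 0 := by
  have h := orth_aux m m le_rfl v hv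
  simp only [legPoly, eval_mul, eval_C, mul_assoc]
  rw [intervalIntegral.integral_const_mul, h, mul_zero]

/-- affine map from the cell to the reference interval -/
noncomputable def aff (a b : ℝ) : ℝ[X] := C (2 / (b - a)) * X + C (-(a + b) / (b - a))

noncomputable def affInv (a b : ℝ) : ℝ[X] := C ((b - a) / 2) * X + C ((a + b) / 2)

lemma aff_eval (a b x : ℝ) : (aff a b).eval x = (2 * x - (a + b)) / (b - a) := by
  simp [aff]; ring

lemma legendreCell_eq (m : ℕ) (a b x : ℝ) :
    legendreCell m a b x = ((legPoly m).comp (aff a b)).eval x := by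
  rw [eval_comp, aff_eval, legendreCell, legendreP_eq]

lemma affInv_comp_aff {a b : ℝ} (h : a < b) : (affInv a b).comp (aff a b) = X := by
  have : b - a ≠ 0 := by linarith
  apply Polynomial.funext
  intro x
  rw [eval_comp, aff_eval]; simp [affInv]; field_simp; ring

lemma aff_natDegree (a b : ℝ) : (aff a b).natDegree ≤ 1 := natDegree_linear_le
lemma affInv_natDegree (a b : ℝ) : (affInv a b).natDegree ≤ 1 := natDegree_linear_le

lemma aff_left {a b : ℝ} (h : a < b) : (aff a b).eval a = -1 := by
  have : b - a ≠ 0 := by linarith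
  rw [aff_eval]; field_simp; ring
lemma aff_right {a b : ℝ} (h : a < b) : (aff a b).eval b = 1 := by
  have : b - a ≠ 0 := by linarith
  rw [aff_eval]; field_simp; ring

lemma comp_natDegree {p q : ℝ[X]} (hq : q.natDegree ≤ 1) : (p.comp q).natDegree ≤ p.natDegree := by
  refine natDegree_comp_le.trans ?_
  nlinarith

lemma integral_comp_aff {a b : ℝ} (h : a < b) (p : ℝ[X]) :
    ∫ x in a..b, (p.comp (aff a b)).eval x = ((b - a) / 2) * ∫ x in (-1:ℝ)..1, p.eval x := by
  have h0 : b - a ≠ 0 := by linarith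
  have h1 : (2 / (b - a)) ≠ 0 := by positivity
  have := intervalIntegral.integral_comp_mul_add (a := a) (b := b) (fun x => p.eval x) h1 (-(a + b) / (b - a))
  have e1 := aff_left h
  have e2 := aff_right h
  simp only [aff, eval_add, eval_mul, eval_C, eval_X] at e1 e2
  rw [e1, e2] at this
  simp only [eval_comp, aff, eval_add, eval_mul, eval_C, eval_X]
  rw [this, smul_eq_mul, inv_div]

lemma lp_orth_cell {a b : ℝ} (h : a < b) (m : ℕ) (v : ℝ[X]) (hv : v.natDegree < m) :
    ∫ x in a..b, ((legPoly m).comp (aff a b)).eval x * v.eval x = 0 := by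
  have hv' : v = (v.comp (affInv a b)).comp (aff a b) := by
    rw [comp_assoc, affInv_comp_aff h, comp_X]
  have : ∫ x in a..b, ((legPoly m).comp (aff a b)).eval x * v.eval x
      = ∫ x in a..b, ((legPoly m * v.comp (affInv a b)).comp (aff a b)).eval x := by
    congr 1
    funext x
    rw [mul_comp, ← hv', eval_mul]
  rw [this, integral_comp_aff h]
  simp only [eval_mul]
  rw [lp_orth m _ ((comp_natDegree (affInv_natDegree a b)).trans_lt hv), mul_zero]

lemma Dinv_eq {a b : ℝ} (h : a < b) (q : ℝ[X]) (hq : q.eval (-1) = 0) :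
    Dinv a b (fun x => ((derivative q).comp (aff a b)).eval x)
      = fun x => (q.comp (aff a b)).eval x := by
  funext x
  have h0 : b - a ≠ 0 := by linarith
  have hd : derivative (q.comp (aff a b)) = C (2 / (b - a)) * (derivative q).comp (aff a b) := by
    rw [derivative_comp]; congr 1; simp [aff]
  have := intervalIntegral.integral_eq_sub_of_hasDerivAt (a := a) (b := x)
    (fun y _ => (q.comp (aff a b)).hasDerivAt y)
    ((derivative (q.comp (aff a b))).continuous.intervalIntegrable _ _)
  rw [hd] at this
  simp only [eval_mul, eval_C] at this
  rw [intervalIntegral.integral_const_mul] at this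
  rw [Dinv, this, eval_comp (x := a), aff_left h, hq, sub_zero]

lemma proj_unique {a b : ℝ} (h : a < b) (k : ℕ) (hk : 1 ≤ k) (P : ℝ[X]) (hd : P.natDegree ≤ k)
    (ho : ∀ v : ℝ[X], v.natDegree + 1 ≤ k → ∫ x in a..b, P.eval x * v.eval x = 0)
    (hb : P.eval b = 0) : P = 0 := by
  obtain ⟨Q, rfl⟩ := dvd_iff_isRoot.mpr hb
  by_cases hQ : Q = 0
  · simp [hQ]
  exfalso
  rw [natDegree_mul (X_sub_C_ne_zero b) hQ, natDegree_X_sub_C] at hd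
  have h1 := ho Q (by omega)
  have hpos : 0 < ∫ x in a..b, (b - x) * Q.eval x ^ 2 := by
    have hz : ∃ c ∈ Set.Ioo a b, Q.eval c ≠ 0 := by
      by_contra! hc
      exact hQ (eq_zero_of_infinite_isRoot Q ((Set.Ioo_infinite h).mono hc))
    obtain ⟨c, hc, hne⟩ := hz
    refine intervalIntegral.integral_pos h (by fun_prop) ?_ ⟨c, Set.Ioo_subset_Icc_self hc, ?_⟩
    · intro x hx
      exact mul_nonneg (by linarith [hx.2]) (sq_nonneg _)
    · exact mul_pos (by linarith [hc.2]) (by positivity)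
  have : ∫ x in a..b, (b - x) * Q.eval x ^ 2 = - ∫ x in a..b, ((X - C b) * Q).eval x * Q.eval x := by
    rw [← intervalIntegral.integral_neg]
    congr 1; funext x; simp; ring
  linarith

/-- `L_m - L_{m-1}` -/
noncomputable def MM (m : ℕ) : ℝ[X] := legPoly m - legPoly (m - 1)

lemma MM_one (m : ℕ) : (MM m).eval 1 = 0 := by simp [MM, lp_eval_one]

lemma MM_deg (m : ℕ) : (MM m).natDegree ≤ m :=
  (natDegree_sub_le_of_le (lp_natDegree m) (lp_natDegree (m - 1))).trans (by omega)

lemma MM_deriv (j : ℕ) : derivative (MM (j + 2) + MM (j + 1)) = C (2 * (j:ℝ) + 3) * legPoly (j + 1) := by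
  rw [← lp_deriv]; congr 1; simp [MM]

lemma MM_neg (j : ℕ) : (MM (j + 2) + MM (j + 1)).eval (-1) = 0 := by
  simp [MM, lp_eval_neg_one, pow_succ]

lemma proj_eq {a b : ℝ} (h : a < b) (k : ℕ) (hk : 1 ≤ k) (p P : ℝ[X]) (d : ℝ)
    (hp : p.natDegree ≤ k)
    (hP : IsGRProj k a b (fun x => ((d • MM (k + 1) + p).comp (aff a b)).eval x) P) :
    P = p.comp (aff a b) := by
  obtain ⟨h1, h2, h3⟩ := hP
  rw [← sub_eq_zero]
  have hpd := (comp_natDegree (p := p) (aff_natDegree a b)).trans hp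
  refine proj_unique h k hk _ ((natDegree_sub_le_of_le h1 hpd).trans (by simp)) ?_ ?_
  · intro v hv
    have e1 := h2 v hv
    have o1 := lp_orth_cell h (k + 1) v (by omega)
    have o2 := lp_orth_cell h k v (by omega)
    have e2 : ∫ x in a..b, ((d • MM (k + 1) + p).comp (aff a b)).eval x * v.eval x
       = d * ((∫ x in a..b, ((legPoly (k + 1)).comp (aff a b)).eval x * v.eval x)
          - ∫ x in a..b, ((legPoly k).comp (aff a b)).eval x * v.eval x)
          + ∫ x in a..b, (p.comp (aff a b)).eval x * v.eval x := by
      rw [← intervalIntegral.integral_sub, ← intervalIntegral.integral_const_mul,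
        ← intervalIntegral.integral_add]
      · congr 1; funext x; simp [MM]; ring
      all_goals exact (by fun_prop : Continuous _).intervalIntegrable _ _
    rw [o1, o2] at e2
    have e3 : ∫ x in a..b, (P - p.comp (aff a b)).eval x * v.eval x
       = (∫ x in a..b, P.eval x * v.eval x)
          - ∫ x in a..b, (p.comp (aff a b)).eval x * v.eval x := by
      rw [← intervalIntegral.integral_sub]
      · congr 1; funext x; simp; ring
      all_goals exact (by fun_prop : Continuous _).intervalIntegrable _ _
    rw [e3, e1, e2]; ring
  · rw [eval_sub, h3]
    simp [eval_comp, aff_right h, MM_one]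

open Submodule in
lemma step (n k : ℕ) (hn : 1 ≤ n) (p : ℝ[X])
    (hp : p ∈ span ℝ (MM '' ↑(Finset.Icc (n + 1) k))) :
    ∃ q ∈ span ℝ (MM '' ↑(Finset.Icc n (k + 1))), derivative q = p ∧ q.eval (-1) = 0 := by
  induction hp using Submodule.span_induction with
  | mem x hx =>
    obtain ⟨m, hm, rfl⟩ := hx
    simp only [Finset.coe_Icc, Set.mem_Icc] at hm
    obtain ⟨j, rfl⟩ : ∃ j, m = j + 2 := ⟨m - 2, by omega⟩
    have mem : ∀ i, n ≤ i → i ≤ k + 1 → MM i ∈ span ℝ (MM '' ↑(Finset.Icc n (k + 1))) :=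
      fun i h1 h2 => subset_span ⟨i, by simp [h1, h2], rfl⟩
    refine ⟨(1 / (2 * (j:ℝ) + 5)) • (MM (j + 3) + MM (j + 2))
      - (1 / (2 * (j:ℝ) + 3)) • (MM (j + 2) + MM (j + 1)), ?_, ?_, ?_⟩
    · exact sub_mem (smul_mem _ _ (add_mem (mem _ (by omega) (by omega)) (mem _ (by omega) (by omega))))
        (smul_mem _ _ (add_mem (mem _ (by omega) (by omega)) (mem _ (by omega) (by omega))))
    · have d1 := MM_deriv j
      have d2 := MM_deriv (j + 1)
      rw [derivative_sub, derivative_smul, derivative_smul, d1, d2, smul_eq_C_mul, smul_eq_C_mul,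
        ← mul_assoc, ← mul_assoc, ← map_mul, ← map_mul]
      have c1 : 1 / (2 * (j:ℝ) + 5) * (2 * ((j + 1 : ℕ):ℝ) + 3) = 1 := by
        push_cast; field_simp; ring
      have c2 : 1 / (2 * (j:ℝ) + 3) * (2 * (j:ℝ) + 3) = 1 := by field_simp
      rw [c1, c2]; simp [MM]
    · have d1 := MM_neg j
      have d2 := MM_neg (j + 1)
      rw [eval_sub, eval_smul, eval_smul, d1, d2]; simp
  | zero => exact ⟨0, zero_mem _, by simp, by simp⟩
  | add x y _ _ hx hy =>
    obtain ⟨q, a1, a2, a3⟩ := hx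
    obtain ⟨r, b1, b2, b3⟩ := hy
    exact ⟨q + r, add_mem a1 b1, by simp [a2, b2], by simp [a3, b3]⟩
  | smul c x _ hx =>
    obtain ⟨q, a1, a2, a3⟩ := hx
    exact ⟨c • q, smul_mem _ _ a1, by simp [a2], by simp [a3]⟩

open Submodule in
lemma span_facts (n k : ℕ) (p : ℝ[X])
    (hp : p ∈ span ℝ (MM '' ↑(Finset.Icc n k))) : p.natDegree ≤ k ∧ p.eval 1 = 0 := by
  induction hp using Submodule.span_induction with
  | mem x hx =>
    obtain ⟨m, hm, rfl⟩ := hx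
    simp only [Finset.coe_Icc, Set.mem_Icc] at hm
    exact ⟨(MM_deg m).trans hm.2, MM_one m⟩
  | zero => simp
  | add x y _ _ hx hy => exact ⟨natDegree_add_le_of_degree_le hx.1 hy.1, by simp [hx.2, hy.2]⟩
  | smul c x _ hx => exact ⟨(natDegree_smul_le _ _).trans hx.1, by simp [hx.2]⟩

lemma F_one (k : ℕ) (hk : 1 ≤ k) (a b : ℝ) (h : a < b) (F : ℕ → ℝ[X]) (hF : IsFSeq k a b F) :
    F 1 = ((1 / (2 * (k:ℝ) + 1)) • MM k).comp (aff a b) := by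
  obtain ⟨j, rfl⟩ : ∃ j, k = j + 1 := ⟨k - 1, by omega⟩
  have h1 := hF.1
  set c : ℝ := 1 / (2 * ((j + 1 : ℕ):ℝ) + 1) with hc
  have hd : derivative (c • MM (j + 1 + 1) + c • MM (j + 1)) = legPoly (j + 1) := by
    rw [← smul_add, derivative_smul, MM_deriv, smul_eq_C_mul, ← mul_assoc, ← map_mul]
    have : c * (2 * (j:ℝ) + 3) = 1 := by rw [hc]; push_cast; field_simp; ring
    rw [this]; simp
  have he : (c • MM (j + 1 + 1) + c • MM (j + 1)).eval (-1) = 0 := by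
    rw [← smul_add, eval_smul, MM_neg]; simp
  have hl : legendreCell (j + 1) a b
      = fun x => ((derivative (c • MM (j + 1 + 1) + c • MM (j + 1))).comp (aff a b)).eval x := by
    funext x; rw [hd, legendreCell_eq]
  rw [hl, Dinv_eq h _ he] at h1
  exact proj_eq h _ hk _ _ c ((natDegree_smul_le _ _).trans (MM_deg _)) h1

open Submodule in
lemma F_repr (k : ℕ) (hk : 1 ≤ k) (i : ℕ) (hi : 1 ≤ i) : i ≤ k →
    ∃ p ∈ span ℝ (MM '' ↑(Finset.Icc (k - i + 1) k)),
      ∀ (a b : ℝ), a < b → ∀ F : ℕ → ℝ[X], IsFSeq k a b F → F i = p.comp (aff a b) := by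
  induction i, hi using Nat.le_induction with
  | base =>
    intro _
    exact ⟨_, smul_mem _ _ (subset_span ⟨k, by simp; omega, rfl⟩), F_one k hk⟩
  | succ i hi ih =>
    intro hik
    obtain ⟨p, hp, hF⟩ := ih (by omega)
    obtain ⟨q, hq, hqd, hq1⟩ := step (k - i) k (by omega) p hp
    have hs : MM '' ↑(Finset.Icc (k - i) (k + 1))
        = insert (MM (k + 1)) (MM '' ↑(Finset.Icc (k - i) k)) := by
      rw [← Set.image_insert_eq]
      congr 1
      ext x
      simp
      omega
    rw [hs, mem_span_insert] at hq
    obtain ⟨d, r, hr, rfl⟩ := hq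
    have hki : k - (i + 1) + 1 = k - i := by omega
    refine ⟨-r, by rw [hki]; exact neg_mem hr, ?_⟩
    intro a b hab F hFs
    have h1 := hFs.2 (i + 1) (by omega)
    simp only [Nat.add_sub_cancel] at h1
    rw [hF a b hab F hFs, ← hqd, Dinv_eq hab _ hq1] at h1
    have := proj_eq hab k hk _ _ d (span_facts _ _ _ hr).1 h1
    rw [neg_comp, ← this, neg_neg]

/-- representation of `F_i` with mesh-independent coefficients `b_{i,m}`,
`F_i(x_{j+1/2}) = 0`, and a uniform bound depending only on `k`. -/
theorem stmt5 (k : ℕ) (hk : 1 ≤ k) :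
    ∃ bc : ℕ → ℕ → ℝ, ∃ C : ℝ, 0 < C ∧
      bc 1 k = 1 / (2*(k:ℝ)+1) ∧
      ∀ (a b : ℝ), a < b → ∀ F : ℕ → Polynomial ℝ, IsFSeq k a b F →
        ∀ i, 1 ≤ i → i ≤ k →
          (∀ y ∈ Set.Icc a b,
            (F i).eval y = ∑ m ∈ Finset.Icc (k-i+1) k,
              bc i m * (legendreCell m a b y - legendreCell (m-1) a b y))
          ∧ (F i).eval b = 0
          ∧ (∀ y ∈ Set.Icc a b, |(F i).eval y| ≤ C) := by
  choose! p hp hF using F_repr k hk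
  have hc : ∀ i, 1 ≤ i → i ≤ k → ∃ c : ℕ → ℝ,
      ∑ m ∈ Finset.Icc (k - i + 1) k, c m • MM m = p i := by
    intro i h1 h2
    exact (Submodule.mem_span_image_finset_iff_exists_fun' ℝ).mp (hp i h1 h2)
  choose! c hc using hc
  obtain ⟨B, hB⟩ := (isCompact_Icc (a := (-1:ℝ)) (b := 1)).exists_bound_of_continuousOn
    (f := fun x => ∑ i ∈ Finset.Icc 1 k, |(p i).eval x|) (by fun_prop)
  refine ⟨fun i m => if i = 1 then 1 / (2*(k:ℝ)+1) else c i m, max B 1, by positivity, by simp, ?_⟩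
  intro a b hab F hFs i h1 h2
  refine ⟨?_, ?_, ?_⟩
  · intro y _
    by_cases hi : i = 1
    · subst hi
      rw [F_one k hk a b hab F hFs]
      have : k - 1 + 1 = k := by omega
      simp [this, legendreCell_eq, MM]
    · simp only [hi, if_false]
      rw [hF i h1 h2 a b hab F hFs, ← hc i h1 h2, eval_comp, eval_finsetSum]
      refine Finset.sum_congr rfl fun m _ => ?_
      simp [legendreCell_eq, MM]
  · rw [hF i h1 h2 a b hab F hFs, eval_comp, aff_right hab, (span_facts _ _ _ (hp i h1 h2)).2]
  · intro y hy
    rw [hF i h1 h2 a b hab F hFs, eval_comp]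
    have hm : (aff a b).eval y ∈ Set.Icc (-1:ℝ) 1 := by
      have : 0 < b - a := by linarith
      rw [aff_eval, Set.mem_Icc, le_div_iff₀ this, div_le_iff₀ this]
      constructor <;> linarith [hy.1, hy.2]
    have h3 := (le_abs_self _).trans (hB _ hm)
    have h4 := Finset.single_le_sum (f := fun i => |(p i).eval ((aff a b).eval y)|)
      (fun _ _ => abs_nonneg _) (Finset.mem_Icc.mpr ⟨h1, h2⟩)
    exact h4.trans (h3.trans (le_max_left _ _))
end

section
/- Let k ≥ 2 and let u(x,t) = u_0(x − t) with u_0 : ℝ → ℝ of class C^{k+1}. Then for every cell τ_j, every index 1 ≤ i ≤ k−1, every t, and every polynomial v of degree ≤ k, ∫_{τ_j} ∂_t w_i(x,t) v(x) dx = ∫_{τ_j} w_{i+1}(x,t) v'(x) dx. -/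
open MeasureTheory intervalIntegral

open Polynomial in
lemma aux_antideriv (v : Polynomial ℝ) (b : ℝ) : ∃ V : Polynomial ℝ,
    V.derivative = v ∧ V.natDegree ≤ v.natDegree + 1 ∧ V.eval b = 0 := by
  let W : Polynomial ℝ := ∑ n ∈ Finset.range (v.natDegree + 1),
    monomial (n + 1) (v.coeff n / ((n : ℝ) + 1))
  have hd : W.derivative = v := by
    conv_rhs => rw [v.as_sum_range]
    simp only [W, Polynomial.derivative_sum]
    refine Finset.sum_congr rfl fun n _ => ?_
    rw [Polynomial.derivative_monomial]
    have : ((n : ℝ) + 1) ≠ 0 := by positivity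
    simp [this]
  refine ⟨W - C (W.eval b), by simp [hd], ?_, by simp⟩
  rw [Polynomial.natDegree_sub_C]
  refine Polynomial.natDegree_sum_le_of_forall_le _ _ fun n hn => ?_
  have := Finset.mem_range.1 hn
  exact (Polynomial.natDegree_monomial_le _).trans (by omega)

/-- Integration by parts for `Dinv`. -/
lemma aux_parts (a b : ℝ) (f : ℝ → ℝ) (hf : Continuous f) (V : Polynomial ℝ) :
    (∫ x in a..b, Dinv a b f x * V.derivative.eval x)
      = Dinv a b f b * V.eval b - (2 / (b - a)) * ∫ x in a..b, f x * V.eval x := by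
  have h := intervalIntegral.integral_mul_deriv_eq_deriv_mul (a := a) (b := b)
    (u := Dinv a b f) (v := fun x => V.eval x) (u' := fun x => (2 / (b - a)) * f x)
    (v' := fun x => V.derivative.eval x)
    (fun x _ => (hf.integral_hasStrictDerivAt a x).hasDerivAt.const_mul _)
    (fun x _ => V.hasDerivAt x)
    ((continuous_const.mul hf).intervalIntegrable _ _)
    (V.derivative.continuous.intervalIntegrable _ _)
  rw [h]
  have h0 : Dinv a b f a = 0 := by simp [Dinv]
  rw [h0, zero_mul, sub_zero, ← intervalIntegral.integral_const_mul]
  simp only [mul_assoc]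

/-- Orthogonality is passed on by the projected primitive. -/
lemma aux_step (k m : ℕ) (a b : ℝ) (f : ℝ → ℝ) (hf : Continuous f) (P : Polynomial ℝ)
    (hmk : m ≤ k) (hP : IsGRProj k a b (Dinv a b f) P)
    (hort : ∀ v : Polynomial ℝ, v.natDegree < m + 1 → ∫ x in a..b, f x * v.eval x = 0) :
    ∀ v : Polynomial ℝ, v.natDegree < m → ∫ x in a..b, P.eval x * v.eval x = 0 := by
  intro v hv
  obtain ⟨V, hV, hdeg, hb⟩ := aux_antideriv v b
  rw [hP.2.1 v (by omega), ← hV, aux_parts a b f hf V, hb, hort V (by omega)]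
  simp

lemma aux_rodrigues (n : ℕ) : ∀ (P : Polynomial ℝ) (a b : ℝ),
    (∀ j < n, (Polynomial.derivative^[j] P).eval a = 0 ∧
      (Polynomial.derivative^[j] P).eval b = 0) →
    ∀ q : Polynomial ℝ, q.natDegree < n →
    ∫ x in a..b, (Polynomial.derivative^[n] P).eval x * q.eval x = 0 := by
  induction n with
  | zero => intro P a b _ q hq; omega
  | succ n ih =>
    intro P a b hP q hq
    have h := intervalIntegral.integral_mul_deriv_eq_deriv_mul (a := a) (b := b)
      (u := fun x => (Polynomial.derivative^[n] P).eval x) (v := fun x => q.eval x)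
      (u' := fun x => (Polynomial.derivative (Polynomial.derivative^[n] P)).eval x)
      (v' := fun x => q.derivative.eval x)
      (fun x _ => Polynomial.hasDerivAt _ x) (fun x _ => Polynomial.hasDerivAt _ x)
      ((Polynomial.continuous _).intervalIntegrable _ _)
      ((Polynomial.continuous _).intervalIntegrable _ _)
    obtain ⟨ha, hb⟩ := hP n (by omega)
    rw [ha, hb] at h
    rw [Function.iterate_succ_apply']
    have h2 : ∫ x in a..b, (Polynomial.derivative^[n] P).eval x * q.derivative.eval x = 0 := by
      by_cases hq0 : q.natDegree = 0
      · rw [Polynomial.eq_C_of_natDegree_eq_zero hq0]; simp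
      · exact ih P a b (fun j hj => hP j (by omega)) _
          (lt_of_lt_of_le (Polynomial.natDegree_derivative_lt hq0) (by omega))
    linarith

lemma aux_legendre_eq (m : ℕ) (s : ℝ) : legendreP m s
    = (1 / ((2:ℝ) ^ m * (Nat.factorial m : ℝ))) *
      (Polynomial.derivative^[m] ((Polynomial.X ^ 2 - 1 : Polynomial ℝ) ^ m)).eval s := by
  unfold legendreP
  congr 1
  have : (fun t : ℝ => (t ^ 2 - 1) ^ m)
      = fun t => ((Polynomial.X ^ 2 - 1 : Polynomial ℝ) ^ m).eval t := by
    funext t; simp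
  rw [this, iteratedDeriv_eq_iterate]
  have key : ∀ (n : ℕ) (p : Polynomial ℝ), deriv^[n] (fun t => p.eval t)
      = fun t => (Polynomial.derivative^[n] p).eval t := by
    intro n
    induction n with
    | zero => intro p; rfl
    | succ n ih =>
      intro p
      rw [Function.iterate_succ_apply, Function.iterate_succ_apply, ← ih]
      congr 1
      funext t
      exact p.deriv
  rw [key]

lemma aux_legendre_orth (m : ℕ) (q : Polynomial ℝ) (hq : q.natDegree < m) :
    ∫ s in (-1:ℝ)..1, legendreP m s * q.eval s = 0 := by
  have := aux_rodrigues m ((Polynomial.X ^ 2 - 1 : Polynomial ℝ) ^ m) (-1) 1 (by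
    intro j hj
    have hd : (Polynomial.X ^ 2 - 1 : Polynomial ℝ) ∣
        Polynomial.derivative^[j] ((Polynomial.X ^ 2 - 1 : Polynomial ℝ) ^ m) :=
      (dvd_pow_self _ (by omega)).trans
        (Polynomial.pow_sub_dvd_iterate_derivative_of_pow_dvd j (dvd_refl _))
    obtain ⟨r, hr⟩ := hd
    rw [hr]; simp) q hq
  simp only [aux_legendre_eq, mul_assoc]
  rw [intervalIntegral.integral_const_mul, this, mul_zero]

lemma aux_cell_cont (m : ℕ) (a b : ℝ) : Continuous (legendreCell m a b) := by
  unfold legendreCell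
  simp only [aux_legendre_eq]
  exact continuous_const.mul ((Polynomial.continuous _).comp (by fun_prop))

lemma aux_cell_orth (m : ℕ) (a b : ℝ) (hab : a < b) (q : Polynomial ℝ) (hq : q.natDegree < m) :
    ∫ x in a..b, legendreCell m a b x * q.eval x = 0 := by
  have hne : b - a ≠ 0 := by linarith
  let l : Polynomial ℝ := Polynomial.C ((b - a) / 2) * Polynomial.X + Polynomial.C ((a + b) / 2)
  have hl : l.natDegree ≤ 1 := Polynomial.natDegree_linear_le
  have h0 := aux_legendre_orth m (q.comp l) (by
    refine lt_of_le_of_lt Polynomial.natDegree_comp_le ?_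
    nlinarith)
  have h1 := intervalIntegral.integral_comp_mul_add (a := a) (b := b)
    (f := fun s => legendreP m s * (q.comp l).eval s) (c := 2 / (b - a))
    (by positivity) (-(a + b) / (b - a))
  have e1 : 2 / (b - a) * a + -(a + b) / (b - a) = -1 := by field_simp; ring
  have e2 : 2 / (b - a) * b + -(a + b) / (b - a) = 1 := by field_simp; ring
  rw [e1, e2, h0, smul_zero] at h1
  rw [← h1]
  refine intervalIntegral.integral_congr fun x _ => ?_
  have e3 : 2 / (b - a) * x + -(a + b) / (b - a) = (2 * x - (a + b)) / (b - a) := by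
    field_simp; ring
  have e4 : l.eval ((2 * x - (a + b)) / (b - a)) = x := by
    simp only [l, Polynomial.eval_add, Polynomial.eval_mul, Polynomial.eval_C, Polynomial.eval_X]
    field_simp; ring
  simp only [e3, Polynomial.eval_comp, e4, legendreCell]

lemma aux_F_orth (k : ℕ) (a b : ℝ) (hab : a < b) (F : ℕ → Polynomial ℝ) (hF : IsFSeq k a b F)
    (i : ℕ) : ∀ m, m + (i + 1) = k → ∀ v : Polynomial ℝ, v.natDegree < m →
      ∫ x in a..b, (F (i + 1)).eval x * v.eval x = 0 := by
  induction i with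
  | zero =>
    intro m hm
    exact aux_step k m a b _ (aux_cell_cont k a b) _ (by omega) hF.1
      fun v hv => aux_cell_orth k a b hab v (by omega)
  | succ i ih =>
    intro m hm v hv
    have := aux_step k m a b _ (F (i + 1)).continuous _ (by omega) (hF.2 (i + 1 + 1) (by omega))
      (ih (m + 1) (by omega)) v hv
    simpa using this

/-- `∫ ∂_t w_i v = ∫ w_{i+1} v'` for `1 ≤ i ≤ k-1` and `v` of degree ≤ k. -/
theorem stmt7 (k : ℕ) (hk : 2 ≤ k) (u0 : ℝ → ℝ) (hu0 : ContDiff ℝ (k+1) u0)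
    (a b : ℝ) (hab : a < b)
    (F : ℕ → Polynomial ℝ) (hF : IsFSeq k a b F)
    (i : ℕ) (hi1 : 1 ≤ i) (hik : i ≤ k - 1)
    (t : ℝ) (v : Polynomial ℝ) (hv : v.natDegree ≤ k) :
    (∫ y in a..b, deriv (fun s => wFun k a b u0 F i y s) t * v.eval y)
      = ∫ y in a..b, wFun k a b u0 F (i+1) y t * v.derivative.eval y := by
  obtain ⟨i, rfl⟩ : ∃ n, i = n + 1 := ⟨i - 1, by omega⟩
  have hne : b - a ≠ 0 := by linarith
  have hd : ∀ y, deriv (fun s => wFun k a b u0 F (i + 1) y s) t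
      = ((b - a) / 2) ^ (i + 1) * Gfun k a b u0 (i + 1 + 1) t * (F (i + 1)).eval y := by
    intro y
    have : deriv (Gfun k a b u0 (i + 1)) t = Gfun k a b u0 (i + 1 + 1) t := by
      unfold Gfun
      rw [iteratedDeriv_succ (n := i + 1)]
    unfold wFun
    rw [deriv_mul_const_field, deriv_const_mul_field]
    rw [this]
  simp only [hd]
  unfold wFun
  simp only [mul_assoc]
  simp only [intervalIntegral.integral_const_mul]
  have h0 : ∫ x in a..b, (F (i + 1)).eval x = 0 := by
    have := aux_F_orth k a b hab F hF i (k - (i + 1)) (by omega) 1 (by simp; omega)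
    simpa using this
  have hdeg : v.derivative.natDegree + 1 ≤ k := by
    have := Polynomial.natDegree_derivative_le v
    omega
  have h1 := (hF.2 (i + 1 + 1) (by omega)).2.1 v.derivative hdeg
  have h2 := aux_parts a b (fun x => (F (i + 1)).eval x) (F (i + 1)).continuous v
  have h3 : Dinv a b (fun x => (F (i + 1)).eval x) b = 0 := by simp [Dinv, h0]
  simp only [Nat.add_sub_cancel] at h1
  rw [h2, h3] at h1
  simp only [Polynomial.eval_neg, neg_mul, intervalIntegral.integral_neg] at h1
  have h4 : ∫ x in a..b, (F (i + 1 + 1)).eval x * v.derivative.eval x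
      = 2 / (b - a) * ∫ x in a..b, (F (i + 1)).eval x * v.eval x := by linarith
  rw [h4, pow_succ ((b - a) / 2) (i + 1)]
  field_simp
end
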